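/- arXiv:1808.08109 — 4 statements merged into one kernel-verified Lean document; each statement's English description precedes it below -/
import Mathlib

section
/- Let b be a real number with 0 < b ≤ 3/2, and set r = √(9 − 4b²). Then the point (x₁, x₂, y₁, y₂) with x₁ = √((3−r)/b)·(3 + 2r)/(3√2·b), x₂ = −√((3−r)/b)·(9 − 8b² + 3r)/(6√2·b²), y₁ = −√((3−r)/(2b)), y₂ = −√(2b)/√(3−r) satisfies simultaneously the five equations: y₁²y₂² − 1 = 0; (y₂ + b·x₂) + y₂²·(y₁ + b·x₁) = 0; (y₁ + b·x₁) + y₁²·(y₂ + b·x₂) = 0; x₁ − y₁³/3 + y₂ = 0; x₂ − y₂³/3 + y₁ = 0. -/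
open Real

/-- For 0 < b ≤ 3/2 and r = √(9 − 4b²), the explicit parameter-dependent point
(x₁, x₂, y₁, y₂) of Eq. (35b) satisfies the five equations defining the pseudo
singular points of the coupled FitzHugh-Nagumo system. -/
theorem stmt_5 (b : ℝ) (hb : 0 < b) (hb' : b ≤ 3/2)
    (r x1 x2 y1 y2 : ℝ)
    (hr : r = Real.sqrt (9 - 4 * b^2))
    (hx1 : x1 = Real.sqrt ((3 - r) / b) * (3 + 2 * r) / (3 * Real.sqrt 2 * b))
    (hx2 : x2 = -(Real.sqrt ((3 - r) / b) * (9 - 8 * b^2 + 3 * r) / (6 * Real.sqrt 2 * b^2)))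
    (hy1 : y1 = -Real.sqrt ((3 - r) / (2 * b)))
    (hy2 : y2 = -(Real.sqrt (2 * b) / Real.sqrt (3 - r))) :
    y1^2 * y2^2 - 1 = 0 ∧
    (y2 + b * x2) + y2^2 * (y1 + b * x1) = 0 ∧
    (y1 + b * x1) + y1^2 * (y2 + b * x2) = 0 ∧
    x1 - y1^3 / 3 + y2 = 0 ∧
    x2 - y2^3 / 3 + y1 = 0 := by
  have h0 : 0 ≤ 9 - 4 * b^2 := by nlinarith
  have hr2 : r^2 = 9 - 4 * b^2 := by rw [hr]; exact Real.sq_sqrt h0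
  have hr3 : 0 < 3 - r := by
    have : 0 < b^2 := by positivity
    nlinarith
  obtain ⟨s, hs⟩ : ∃ s, s = Real.sqrt ((3 - r) / (2 * b)) := ⟨_, rfl⟩
  have hspos : 0 < s := by rw [hs]; positivity
  have hs2 : s^2 = (3 - r) / (2 * b) := by rw [hs]; exact Real.sq_sqrt (by positivity)
  have hq : Real.sqrt ((3 - r) / b) = Real.sqrt 2 * s := by
    rw [hs, ← Real.sqrt_mul (by norm_num)]
    congr 1
    field_simp
  have hy2' : y2 = -(1 / s) := by
    rw [hy2, hs, Real.sqrt_div hr3.le, one_div_div]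
  have hy1' : y1 = -s := by rw [hy1, hs]
  have h2 : Real.sqrt 2 ≠ 0 := by positivity
  have hx1' : x1 = s * (3 + 2 * r) / (3 * b) := by
    rw [hx1, hq]; field_simp
  have hx2' : x2 = -(s * (9 - 8 * b^2 + 3 * r) / (6 * b^2)) := by
    rw [hx2, hq]; field_simp
  have hrs : r = 3 - 2 * b * s^2 := by rw [hs2]; field_simp; ring
  have hbs : b = 3 * s^2 / (1 + s^4) := by
    rw [eq_div_iff (by positivity)]
    have : b * (b * (1 + s^4)) = b * (3 * s^2) := by
      rw [hrs] at hr2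
      linear_combination hr2 / 4
    exact mul_left_cancel₀ hb.ne' this
  clear hx1 hx2 hy1 hy2 hq hr hs hs2 hr2 hr3 h0 hb'
  subst hrs
  subst hbs
  subst hy1' hy2' hx1' hx2'
  have hs4 : 1 + s^4 ≠ 0 := by positivity
  refine ⟨?_, ?_, ?_, ?_, ?_⟩ <;> field_simp <;> ring
end

section
/- Let b and c be real numbers with c ≠ 0, and let J be the 4×4 real matrix with rows: (0, 0, 2(3+4b)/(3c), −2(3+4b)/(3c)), (0, 0, −2(3+4b)/(3c), 2(3+4b)/(3c)), (b/c, b/c, 1/c, −(3+8b)/(3c)), (b/c, b/c, −(3+8b)/(3c), 1/c). Then the characteristic polynomial of J equals λ⁴ − (2/c)·λ³ − (16b(3+4b)/(9c²))·λ²; in particular det J = 0, the sum of all 3×3 principal minors of J is 0, the trace of J is 2/c, and the sum of all 2×2 principal minors of J is −16b(3+4b)/(9c²). -/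
open Polynomial Matrix

/-- The 2×2 principal minor of a 4×4 matrix with rows/columns {i, j}. -/
noncomputable def pminor2 (J : Matrix (Fin 4) (Fin 4) ℝ) (i j : Fin 4) : ℝ :=
  Matrix.det !![J i i, J i j; J j i, J j j]

/-- The 3×3 principal minor of a 4×4 matrix with rows/columns {i, j, k}. -/
noncomputable def pminor3 (J : Matrix (Fin 4) (Fin 4) ℝ) (i j k : Fin 4) : ℝ :=
  Matrix.det !![J i i, J i j, J i k; J j i, J j j, J j k; J k i, J k j, J k k]

/-- The sum of all 2×2 principal (diagonal) minors of a 4×4 matrix. -/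
noncomputable def sumPminor2 (J : Matrix (Fin 4) (Fin 4) ℝ) : ℝ :=
  pminor2 J 0 1 + pminor2 J 0 2 + pminor2 J 0 3 +
  pminor2 J 1 2 + pminor2 J 1 3 + pminor2 J 2 3

/-- The sum of all 3×3 principal (diagonal) minors of a 4×4 matrix. -/
noncomputable def sumPminor3 (J : Matrix (Fin 4) (Fin 4) ℝ) : ℝ :=
  pminor3 J 0 1 2 + pminor3 J 0 1 3 + pminor3 J 0 2 3 + pminor3 J 1 2 3

theorem aux_charpoly (p q r s : ℝ) :
    (!![0, 0, p, -p; 0, 0, -p, p; q, q, r, -s; q, q, -s, r] : Matrix (Fin 4) (Fin 4) ℝ).charpoly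
      = X^4 - 2 * C r * X^3 + (C r ^ 2 - C s ^ 2) * X^2 := by
  have h : (!![0, 0, p, -p; 0, 0, -p, p; q, q, r, -s; q, q, -s, r] :
      Matrix (Fin 4) (Fin 4) ℝ).charmatrix =
      !![X, 0, -C p, C p; 0, X, C p, -C p; -C q, -C q, X - C r, C s; -C q, -C q, C s, X - C r] := by
    ext1 i j
    fin_cases i <;> fin_cases j <;> simp [Matrix.charmatrix_apply]
  rw [Matrix.charpoly, h]
  simp [Matrix.det_succ_row_zero, Fin.sum_univ_succ, Fin.succAbove]
  ring

/-- The characteristic polynomial of the Jacobian matrix of the normalized slow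
dynamics of the coupled FitzHugh-Nagumo system at the pseudo singular points
(±4/3, ∓4/3, ±1, ∓1) is λ⁴ − (2/c)λ³ − (16b(3+4b)/(9c²))λ²; in particular its
determinant and sum of 3×3 principal minors vanish, its trace is 2/c and its
sum of 2×2 principal minors is −16b(3+4b)/(9c²). -/
theorem stmt_6 (b c : ℝ) (hc : c ≠ 0)
    (J : Matrix (Fin 4) (Fin 4) ℝ)
    (hJ : J = !![0, 0, 2*(3+4*b)/(3*c), -(2*(3+4*b)/(3*c));
                 0, 0, -(2*(3+4*b)/(3*c)), 2*(3+4*b)/(3*c);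
                 b/c, b/c, 1/c, -((3+8*b)/(3*c));
                 b/c, b/c, -((3+8*b)/(3*c)), 1/c]) :
    J.charpoly = X^4 - C (2/c) * X^3 - C (16*b*(3+4*b)/(9*c^2)) * X^2 ∧
    J.det = 0 ∧
    sumPminor3 J = 0 ∧
    J.trace = 2/c ∧
    sumPminor2 J = -(16*b*(3+4*b)/(9*c^2)) := by
  subst hJ
  refine ⟨?_, ?_, ?_, ?_, ?_⟩
  · rw [aux_charpoly]
    have h1 : (2/c : ℝ) = 2 * (1/c) := by ring
    have h2 : (16*b*(3+4*b)/(9*c^2) : ℝ) = ((3+8*b)/(3*c))^2 - (1/c)^2 := by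
      field_simp
      ring
    rw [h1, h2]
    simp only [C_mul, C_sub, C_pow, C_ofNat]
    ring
  · simp [Matrix.det_succ_row_zero, Fin.sum_univ_succ, Fin.succAbove]
    try ring
  · simp [sumPminor3, pminor3, Matrix.det_fin_three]
    try ring
  · simp [Matrix.trace, Fin.sum_univ_succ]
    try ring
  · simp [sumPminor2, pminor2, Matrix.det_fin_two]
    field_simp
    ring
end

section
/- Let b and c be real numbers with c ≠ 0, and let Φ : ℝ⁴ → ℝ⁴ be the map Φ(x₁, x₂, y₁, y₂) = ( −(1/c)(y₁ + b x₁)(y₁²y₂² − 1), −(1/c)(y₂ + b x₂)(y₁²y₂² − 1), (1/c)[(y₂ + b x₂) + y₂²(y₁ + b x₁)], (1/c)[(y₁ + b x₁) + y₁²(y₂ + b x₂)] ). Then the Jacobian matrix of Φ at the point (4/3, −4/3, 1, −1) has trace 2/c, sum of all 2×2 principal minors equal to −16b(3+4b)/(9c²), sum of all 3×3 principal minors equal to 0, and determinant 0; equivalently its characteristic polynomial is λ⁴ − (2/c)·λ³ − (16b(3+4b)/(9c²))·λ². -/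
open Polynomial Matrix

/-- The normalized slow dynamics of the coupled FitzHugh-Nagumo system, as a map
ℝ⁴ → ℝ⁴ on coordinates (x₁, x₂, y₁, y₂) = (v 0, v 1, v 2, v 3). -/
noncomputable def FHNnormalized (b c : ℝ) (v : Fin 4 → ℝ) : Fin 4 → ℝ :=
  ![-(1/c) * (v 2 + b * v 0) * ((v 2)^2 * (v 3)^2 - 1),
    -(1/c) * (v 3 + b * v 1) * ((v 2)^2 * (v 3)^2 - 1),
    (1/c) * ((v 3 + b * v 1) + (v 3)^2 * (v 2 + b * v 0)),
    (1/c) * ((v 2 + b * v 0) + (v 2)^2 * (v 3 + b * v 1))]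

/-- The Jacobian matrix of the normalized slow dynamics of the coupled
FitzHugh-Nagumo system at the pseudo singular point (4/3, −4/3, 1, −1) has
trace 2/c, sum of 2×2 principal minors −16b(3+4b)/(9c²), sum of 3×3 principal
minors 0, determinant 0, and characteristic polynomial
λ⁴ − (2/c)λ³ − (16b(3+4b)/(9c²))λ². -/
theorem stmt_7 (b c : ℝ) (hc : c ≠ 0)
    (p : Fin 4 → ℝ) (hp : p = ![4/3, -(4/3), 1, -1])
    (J : Matrix (Fin 4) (Fin 4) ℝ)
    (hJ : J = Matrix.of fun i j =>
      fderiv ℝ (fun v : Fin 4 → ℝ => FHNnormalized b c v i) p (Pi.single j 1)) :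
    J.trace = 2/c ∧
    sumPminor2 J = -(16*b*(3+4*b)/(9*c^2)) ∧
    sumPminor3 J = 0 ∧
    J.det = 0 ∧
    J.charpoly = X^4 - C (2/c) * X^3 - C (16*b*(3+4*b)/(9*c^2)) * X^2 := by
  have h : ∀ i : Fin 4, HasFDerivAt (fun v : Fin 4 → ℝ => v i)
      (ContinuousLinearMap.proj (R := ℝ) (φ := fun _ : Fin 4 => ℝ) i) p :=
    fun i => hasFDerivAt_apply i p
  have hu := (h 2).add ((h 0).const_mul b)
  have hw := (h 3).add ((h 1).const_mul b)
  have hD := (((h 2).pow 2).mul ((h 3).pow 2)).sub_const 1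
  have e0 := ((hu.const_mul (-(1/c))).mul hD).fderiv
  have e1 := ((hw.const_mul (-(1/c))).mul hD).fderiv
  have e2 := ((hw.add (((h 3).pow 2).mul hu)).const_mul (1/c)).fderiv
  have e3 := ((hu.add (((h 2).pow 2).mul hw)).const_mul (1/c)).fderiv
  have hJ' : J = !![0, 0, -(2*(1+4*b/3)/c), 2*(1+4*b/3)/c;
      0, 0, 2*(1+4*b/3)/c, -(2*(1+4*b/3)/c);
      b/c, b/c, 1/c, (1-2*(1+4*b/3))/c;
      b/c, b/c, (1-2*(1+4*b/3))/c, 1/c] := by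
    rw [hJ]
    ext i j
    rw [Matrix.of_apply]
    fin_cases i
    · refine (congrArg (fun L : (Fin 4 → ℝ) →L[ℝ] ℝ => L (Pi.single j 1)) e0).trans ?_
      clear e0 e1 e2 e3 hu hw hD h hJ
      subst hp
      fin_cases j <;> simp [Pi.single_apply] <;> (try field_simp) <;> (try ring)
    · refine (congrArg (fun L : (Fin 4 → ℝ) →L[ℝ] ℝ => L (Pi.single j 1)) e1).trans ?_
      clear e0 e1 e2 e3 hu hw hD h hJ
      subst hp
      fin_cases j <;> simp [Pi.single_apply] <;> (try field_simp) <;> (try ring)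
    · refine (congrArg (fun L : (Fin 4 → ℝ) →L[ℝ] ℝ => L (Pi.single j 1)) e2).trans ?_
      clear e0 e1 e2 e3 hu hw hD h hJ
      subst hp
      fin_cases j <;> simp [Pi.single_apply] <;> (try field_simp) <;> (try ring)
    · refine (congrArg (fun L : (Fin 4 → ℝ) →L[ℝ] ℝ => L (Pi.single j 1)) e3).trans ?_
      clear e0 e1 e2 e3 hu hw hD h hJ
      subst hp
      fin_cases j <;> simp [Pi.single_apply] <;> (try field_simp) <;> (try ring)
  clear e0 e1 e2 e3 hu hw hD h hJ
  subst hJ'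
  refine ⟨?_, ?_, ?_, ?_, ?_⟩
  · simp [Matrix.trace, Fin.sum_univ_succ]; ring
  · simp [sumPminor2, pminor2, Matrix.det_fin_two]; field_simp; ring
  · simp [sumPminor3, pminor3, Matrix.det_fin_three]; field_simp; ring
  · simp [Matrix.det_succ_row_zero, Fin.sum_univ_succ, Fin.succAbove]; try ring
  · have h1 : 2/c = 2*(1/c) := by ring
    have h2 : 16*b*(3+4*b)/(9*c^2) = -(4*(1/c)^2*(1+4*b/3)*(1-(1+4*b/3))) := by
      field_simp; ring
    have h3 : b/c = b*(1/c) := by ring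
    have h4 : 2*(1+4*b/3)/c = 2*(1+4*b/3)*(1/c) := by ring
    have h5 : (1-2*(1+4*b/3))/c = (1-2*(1+4*b/3))*(1/c) := by ring
    rw [h1, h2, h3, h4, h5]
    generalize 1/c = k
    generalize 1+4*b/3 = u
    simp [Matrix.charpoly, Matrix.charmatrix, Matrix.det_succ_row_zero, Fin.sum_univ_succ, Fin.succAbove]
    have c2 : (C 2 : ℝ[X]) = 2 := rfl
    have c4 : (C 4 : ℝ[X]) = 4 := rfl
    rw [c2, c4]
    ring
end

section
/- Let Ī, gK, gNa, gL, VK, VNa, VL, ȳ, ȳ′, y₂, x₁, x₂ be real numbers satisfying the two equations: (i) Ī − gK·x₁⁴·(y₂ − VK) − gNa·ȳ³·x₂·(y₂ − VNa) − gL·(y₂ − VL) = 0, and (ii) gK·x₁⁴ + gNa·ȳ³·x₂ + gL + 3·gNa·ȳ′·ȳ²·x₂·(y₂ − VNa) = 0. Set D = ȳ·(VK − VNa) − 3·ȳ′·(y₂ − VNa)·(y₂ − VK) and E = ȳ + 3·ȳ′·(y₂ − VNa). Then gNa·ȳ²·x₂·D = Ī − gL·(VK − VL) and gK·x₁⁴·D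 = −Ī·E + gL·[ȳ·(VNa − VL) + 3·ȳ′·(y₂ − VNa)·(y₂ − VL)]. In particular, if D ≠ 0 and gNa·ȳ² ≠ 0 and gK ≠ 0, then x₂ and x₁⁴ are uniquely determined as x₂ = (Ī − gL·(VK − VL))/(gNa·ȳ²·D) and x₁⁴ = (−Ī·E + gL·[ȳ·(VNa − VL) + 3·ȳ′·(y₂ − VNa)·(y₂ − VL)])/(gK·D). -/
/-- Parametric equations of the fold curve of the Hodgkin-Huxley model: from the
critical manifold equation (i) and the fold condition (ii), the quantities
gNa·ȳ²·x₂·D and gK·x₁⁴·D are determined, and if D ≠ 0, gNa·ȳ² ≠ 0, gK ≠ 0 then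
x₂ and x₁⁴ are uniquely determined. -/
theorem stmt_11 (I gK gNa gL VK VNa VL ybar ybar' y2 x1 x2 : ℝ)
    (hi : I - gK * x1^4 * (y2 - VK) - gNa * ybar^3 * x2 * (y2 - VNa)
        - gL * (y2 - VL) = 0)
    (hii : gK * x1^4 + gNa * ybar^3 * x2 + gL
        + 3 * gNa * ybar' * ybar^2 * x2 * (y2 - VNa) = 0)
    (D E : ℝ)
    (hD : D = ybar * (VK - VNa) - 3 * ybar' * (y2 - VNa) * (y2 - VK))
    (hE : E = ybar + 3 * ybar' * (y2 - VNa)) :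
    gNa * ybar^2 * x2 * D = I - gL * (VK - VL) ∧
    gK * x1^4 * D = -(I * E)
      + gL * (ybar * (VNa - VL) + 3 * ybar' * (y2 - VNa) * (y2 - VL)) ∧
    (D ≠ 0 → gNa * ybar^2 ≠ 0 → gK ≠ 0 →
      x2 = (I - gL * (VK - VL)) / (gNa * ybar^2 * D) ∧
      x1^4 = (-(I * E)
        + gL * (ybar * (VNa - VL) + 3 * ybar' * (y2 - VNa) * (y2 - VL)))
        / (gK * D)) := by
  have h1 : gNa * ybar^2 * x2 * D = I - gL * (VK - VL) := by
    subst hD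
    linear_combination -hi - (y2 - VK) * hii
  have h2 : gK * x1^4 * D = -(I * E)
      + gL * (ybar * (VNa - VL) + 3 * ybar' * (y2 - VNa) * (y2 - VL)) := by
    have h3 := h1
    subst hD hE
    linear_combination (ybar * (VK - VNa) - 3 * ybar' * (y2 - VNa) * (y2 - VK)) * hii
      - (ybar + 3 * ybar' * (y2 - VNa)) * h3
  refine ⟨h1, h2, fun hD0 hN hK => ⟨?_, ?_⟩⟩
  · rw [eq_div_iff (mul_ne_zero hN hD0)]
    linear_combination h1
  · rw [eq_div_iff (mul_ne_zero hK hD0)]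
    linear_combination h2
end
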